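/- Let q ∈ L¹([0,1]) be real, let Δ(μ²), M(μ²) = -D(μ²)/Δ(μ²) be the characteristic and Weyl–Titchmarsh functions of the Dirichlet problem on [0,1], and let (α_k²)_{k≥1} be the (simple) zeros of Δ with all α_k ≠ 0. Then the Mittag-Leffler expansion holds: M(μ²) - M(0) = 2 Σ_{k=1}^∞ (Res(m; α_k)/α_k) · μ²/(μ² - α_k²) for μ² ∉ {α_k²}, where m(μ) := M(μ²) is viewed as a meromorphic function of μ with simple poles at ±α_k. -/

import Mathlib

open Set Filter

theorem aux_hilbert {H : Type*} [NormedAddCommGroup H] [InnerProductSpace ℂ H] [CompleteSpace H]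
    (T : H →L[ℂ] H) (hT : IsCompactOperator T) (hS : T.IsSymmetric)
    (e : ℕ → H) (he : Orthonormal ℂ e)
    (hE : ∀ κ : ℂ, κ ≠ 0 → ∀ f : H, T f = κ • f → f ∈ Submodule.span ℂ (range e))
    (v : H) (hv : v ∈ closure (range T)) (w : H) :
    HasSum (fun k => inner ℂ v (e k) * inner ℂ (e k) w) (inner ℂ v w) := by
  classical
  -- orthogonal to the span implies in the kernel
  have hker : ∀ f : H, (∀ k, inner ℂ (e k) f = 0) → T f = 0 := by
    intro f hf
    have hfs : ∀ g ∈ Submodule.span ℂ (range e), inner ℂ g f = 0 := by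
      intro g hg
      induction hg using Submodule.span_induction with
      | mem x hx => obtain ⟨k, rfl⟩ := hx; exact hf k
      | zero => simp
      | add x y _ _ hx hy => rw [inner_add_left, hx, hy, add_zero]
      | smul a x _ hx => rw [inner_smul_left, hx, mul_zero]
    have hbot := T.orthogonalComplement_iSup_eigenspaces_eq_bot hT hS
    have hTf : T f ∈ (⨆ μ, Module.End.eigenspace (T : Module.End ℂ H) μ)ᗮ := by
      rw [Submodule.mem_orthogonal]
      intro u hu
      induction hu using Submodule.iSup_induction' with
      | mem μ x hx =>
        have hx' : T x = μ • x := by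
          simpa using Module.End.mem_eigenspace_iff.1 hx
        have h1 : inner ℂ x (T f) = inner ℂ (T x) f := (hS x f).symm
        rw [h1, hx', inner_smul_left]
        by_cases hμ : μ = 0
        · simp [hμ]
        · rw [hfs x (hE μ hμ x hx'), mul_zero]
      | zero => simp
      | add x y _ _ hx hy => rw [inner_add_left, hx, hy, add_zero]
    rw [hbot] at hTf
    simpa using hTf
  have hperp : ∀ f : H, (∀ k, inner ℂ (e k) f = 0) → inner ℂ v f = 0 := by
    intro f hf
    have h0 := hker f hf
    have hcl : IsClosed {y : H | inner ℂ y f = 0} :=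
      isClosed_eq (by fun_prop) continuous_const
    have : closure (range T) ⊆ {y : H | inner ℂ y f = 0} := by
      apply hcl.closure_subset_iff.2
      rintro _ ⟨g, rfl⟩
      have : inner ℂ (T g) f = inner ℂ g (T f) := hS g f
      simp [this, h0]
    exact this hv
  obtain ⟨s, b, hsub, hb⟩ := he.toSubtypeRange.exists_hilbertBasis_extension
  have hsum := b.hasSum_inner_mul_inner v w
  let j : ℕ → s := fun k => ⟨e k, hsub ⟨k, rfl⟩⟩
  have hj : Function.Injective j := by
    intro k l hkl
    have : e k = e l := congrArg Subtype.val hkl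
    exact he.linearIndependent.injective this
  rw [← hj.hasSum_iff] at hsum
  · have hbj : ∀ k, b (j k) = e k := by intro k; rw [hb]
    simpa [Function.comp_def, hbj] using hsum
  · intro i hi
    have : inner ℂ v (b i) = 0 := by
      apply hperp
      intro k
      have hbk : b (j k) = e k := by rw [hb]
      rw [← hbk]
      exact b.orthonormal.2 (fun h => hi ⟨k, h⟩)
    rw [this, zero_mul]

noncomputable def auxS {X H : Type*} [TopologicalSpace X] [CompactSpace X]
    [NormedAddCommGroup H] [InnerProductSpace ℂ H] (g : C(X, H)) :
    H →L[ℂ] BoundedContinuousFunction X ℂ :=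
  LinearMap.mkContinuous
    { toFun := fun f => BoundedContinuousFunction.mkOfCompact
        ⟨fun x => inner ℂ (g x) f, by fun_prop⟩
      map_add' := by intro a b; ext x; simp
      map_smul' := by intro a b; ext x; simp }
    ‖g‖ (by
      intro f
      rw [BoundedContinuousFunction.norm_le (by positivity)]
      intro x
      exact (norm_inner_le_norm _ _).trans
        (mul_le_mul_of_nonneg_right (g.norm_coe_le_norm x) (norm_nonneg _)))

theorem auxS_apply {X H : Type*} [TopologicalSpace X] [CompactSpace X]
    [NormedAddCommGroup H] [InnerProductSpace ℂ H] (g : C(X, H)) (f : H) (x : X) :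
    auxS g f x = inner ℂ (g x) f := rfl

theorem auxS_compact {X H : Type*} [TopologicalSpace X] [CompactSpace X]
    [NormedAddCommGroup H] [InnerProductSpace ℂ H] (g : C(X, H)) :
    IsCompactOperator (auxS g) := by
  rw [isCompactOperator_iff_exists_mem_nhds_isCompact_closure_image]
  refine ⟨Metric.ball 0 1, Metric.ball_mem_nhds _ one_pos, ?_⟩
  refine BoundedContinuousFunction.arzela_ascoli (Metric.closedBall 0 ‖g‖)
    (isCompact_closedBall _ _) _ ?_ ?_
  · rintro _ x ⟨f, hf, rfl⟩
    rw [mem_ball_zero_iff] at hf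
    rw [mem_closedBall_zero_iff, auxS_apply]
    refine (norm_inner_le_norm _ _).trans ?_
    have := g.norm_coe_le_norm x
    nlinarith [norm_nonneg (g x), norm_nonneg f]
  · intro x₀
    rw [Metric.equicontinuousAt_iff_right]
    intro ε hε
    have hc : Tendsto (fun x => g x) (nhds x₀) (nhds (g x₀)) := g.continuous.continuousAt
    filter_upwards [Metric.tendsto_nhds.1 hc ε hε] with x hx
    rintro ⟨_, f, hf, rfl⟩
    rw [mem_ball_zero_iff] at hf
    change dist (auxS g f x₀) (auxS g f x) < ε
    rw [auxS_apply, auxS_apply, dist_eq_norm, ← inner_sub_left]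
    refine (norm_inner_le_norm _ _).trans_lt ?_
    rw [dist_comm, dist_eq_norm] at hx
    nlinarith [norm_nonneg (g x₀ - g x), norm_nonneg f]

/-- `u'' = q u + g` on `(0,1)`, with `u, u'` continuous up to the boundary. -/
structure AuxSol (q : ℝ → ℝ) (g u u' : ℝ → ℂ) : Prop where
  cu : ContinuousOn u (Icc (0:ℝ) 1)
  cu' : ContinuousOn u' (Icc (0:ℝ) 1)
  d : ∀ x ∈ Ioo (0:ℝ) 1, HasDerivAt u (u' x) x
  d' : ∀ x ∈ Ioo (0:ℝ) 1, HasDerivAt u' ((q x : ℂ) * u x + g x) x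

theorem AuxSol.green {q : ℝ → ℝ} {g u u' h v v' : ℝ → ℂ} (hu : AuxSol q g u u')
    (hv : AuxSol q h v v') (hg : ContinuousOn g (Icc (0:ℝ) 1)) (hh : ContinuousOn h (Icc (0:ℝ) 1))
    {x y : ℝ} (hx : 0 ≤ x) (hxy : x ≤ y) (hy : y ≤ 1) :
    ∫ t in x..y, (g t * v t - u t * h t) =
      (u' y * v y - u y * v' y) - (u' x * v x - u x * v' x) := by
  have hsub : Icc x y ⊆ Icc (0:ℝ) 1 := Icc_subset_Icc hx hy
  have c1 := hu.cu
  have c2 := hu.cu'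
  have c3 := hv.cu
  have c4 := hv.cu'
  have hc : ContinuousOn (fun t => u' t * v t - u t * v' t) (Icc x y) :=
    ContinuousOn.mono (by fun_prop) hsub
  have hc' : ContinuousOn (fun t => g t * v t - u t * h t) (Icc x y) :=
    ContinuousOn.mono (by fun_prop) hsub
  have := intervalIntegral.integral_eq_sub_of_hasDerivAt_of_le hxy hc
    (f' := fun t => g t * v t - u t * h t) ?_ ?_
  · exact this
  · intro t ht
    have ht' : t ∈ Ioo (0:ℝ) 1 := ⟨hx.trans_lt ht.1, ht.2.trans_le hy⟩
    convert! ((hu.d' t ht').mul (hv.d t ht')).sub ((hu.d t ht').mul (hv.d' t ht')) using 1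
    ring
  · apply ContinuousOn.intervalIntegrable
    rwa [uIcc_of_le hxy]

theorem AuxSol.conj {q : ℝ → ℝ} {g u u' : ℝ → ℂ} (hu : AuxSol q g u u') :
    AuxSol q (fun x => star (g x)) (fun x => star (u x)) (fun x => star (u' x)) where
  cu := hu.cu.star
  cu' := hu.cu'.star
  d := fun x hx => (hu.d x hx).star
  d' := fun x hx => by
    convert! (hu.d' x hx).star using 1
    simp

theorem AuxSol.congr {q : ℝ → ℝ} {g h u u' : ℝ → ℂ} (hu : AuxSol q g u u')
    (hgh : ∀ x ∈ Icc (0:ℝ) 1, g x = h x) : AuxSol q h u u' where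
  cu := hu.cu
  cu' := hu.cu'
  d := hu.d
  d' := fun x hx => by rw [← hgh x (Ioo_subset_Icc_self hx)]; exact hu.d' x hx

theorem AuxSol.lin {q : ℝ → ℝ} {g u u' h v v' : ℝ → ℂ} (hu : AuxSol q g u u')
    (hv : AuxSol q h v v') (c : ℂ) :
    AuxSol q (fun x => g x - c * h x) (fun x => u x - c * v x) (fun x => u' x - c * v' x) where
  cu := hu.cu.sub (continuousOn_const.mul hv.cu)
  cu' := hu.cu'.sub (continuousOn_const.mul hv.cu')
  d := fun x hx => (hu.d x hx).sub ((hv.d x hx).const_mul c)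
  d' := fun x hx => by
    convert! (hu.d' x hx).sub ((hv.d' x hx).const_mul c) using 1
    ring

/-- Wronskian of two solutions with the same spectral parameter. -/
theorem AuxSol.wron {q : ℝ → ℝ} {z : ℂ} {u u' v v' : ℝ → ℂ}
    (hu : AuxSol q (fun x => z * u x) u u') (hv : AuxSol q (fun x => z * v x) v v')
    {x y : ℝ} (hx : 0 ≤ x) (hxy : x ≤ y) (hy : y ≤ 1) :
    u' y * v y - u y * v' y = u' x * v x - u x * v' x := by
  have h := hu.green hv (continuousOn_const.mul hu.cu) (continuousOn_const.mul hv.cu) hx hxy hy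
  have h0 : ∀ t, z * u t * v t - u t * (z * v t) = 0 := fun t => by ring
  simp only [h0, intervalIntegral.integral_zero] at h
  exact (sub_eq_zero.1 h.symm)

theorem AuxSol.zero {q : ℝ → ℝ} {z : ℂ} {c c' s s' u u' : ℝ → ℂ}
    (hc : AuxSol q (fun x => z * c x) c c') (hs : AuxSol q (fun x => z * s x) s s')
    (hW : c 0 * s' 0 - c' 0 * s 0 = 1)
    (hu : AuxSol q (fun x => z * u x) u u') (h1 : u 1 = 0) (h1' : u' 1 = 0) :
    ∀ x ∈ Icc (0:ℝ) 1, u x = 0 := by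
  intro x hx
  have e1 := hu.wron hc hx.1 hx.2 le_rfl
  have e2 := hu.wron hs hx.1 hx.2 le_rfl
  have e3 := hc.wron hs le_rfl hx.1 hx.2
  rw [h1, h1'] at e1 e2
  have e4 : c x * s' x - c' x * s x = 1 := by linear_combination hW - e3
  linear_combination (-(u x)) * e4 + c x * e2 - s x * e1

/-- representation of a Dirichlet solution -/
theorem AuxSol.rep {q : ℝ → ℝ} {W : ℂ} {a a' b b' g u u' : ℝ → ℂ}
    (ha : AuxSol q (fun _ => 0) a a') (hb : AuxSol q (fun _ => 0) b b')
    (ha0 : a 0 = 0) (hb1 : b 1 = 0)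
    (hW : ∀ x ∈ Icc (0:ℝ) 1, W = a x * b' x - a' x * b x)
    (hg : ContinuousOn g (Icc (0:ℝ) 1))
    (hu : AuxSol q g u u') (h0 : u 0 = 0) (h1 : u 1 = 0) :
    ∀ x ∈ Icc (0:ℝ) 1, u x * W = b x * (∫ t in (0:ℝ)..x, g t * a t) +
      a x * (∫ t in x..1, g t * b t) := by
  intro x hx
  have e1 := hu.green ha hg continuousOn_const le_rfl hx.1 hx.2
  have e2 := hu.green hb hg continuousOn_const hx.1 hx.2 le_rfl
  simp only [mul_zero, sub_zero] at e1 e2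
  rw [e1, e2, h0, h1, hb1, ha0, hW x hx]
  ring

theorem aux_exists_sol {q : ℝ → ℝ} {W : ℂ} {a a' b b' g : ℝ → ℂ}
    (ha : AuxSol q (fun _ => 0) a a') (hb : AuxSol q (fun _ => 0) b b')
    (ha0 : a 0 = 0) (hb1 : b 1 = 0)
    (hW : ∀ x ∈ Icc (0:ℝ) 1, W = a x * b' x - a' x * b x) (hW0 : W ≠ 0)
    (hg : ContinuousOn g (Icc (0:ℝ) 1)) :
    ∃ u u', AuxSol q g u u' ∧ u 0 = 0 ∧ u 1 = 0 := by
  have ca := ha.cu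
  have cb := hb.cu
  have ca' := ha.cu'
  have cb' := hb.cu'
  have cga : ContinuousOn (fun t => g t * a t) (Icc (0:ℝ) 1) := by fun_prop
  have cgb : ContinuousOn (fun t => g t * b t) (Icc (0:ℝ) 1) := by fun_prop
  set A : ℝ → ℂ := fun x => ∫ t in (0:ℝ)..x, g t * a t with hA
  set B : ℝ → ℂ := fun x => ∫ t in x..1, g t * b t with hB
  have cA : ContinuousOn A (Icc (0:ℝ) 1) := by
    have := intervalIntegral.continuousOn_primitive_interval (a := 0) (b := 1)
      (μ := MeasureTheory.volume) (f := fun t => g t * a t)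
      (by rw [uIcc_of_le zero_le_one]; exact cga.integrableOn_Icc)
    rwa [uIcc_of_le zero_le_one] at this
  have cB : ContinuousOn B (Icc (0:ℝ) 1) := by
    have := intervalIntegral.continuousOn_primitive_interval_left (a := 0) (b := 1)
      (μ := MeasureTheory.volume) (f := fun t => g t * b t)
      (by rw [uIcc_of_le zero_le_one]; exact cgb.integrableOn_Icc)
    rwa [uIcc_of_le zero_le_one] at this
  have dA : ∀ x ∈ Ioo (0:ℝ) 1, HasDerivAt A (g x * a x) x := by
    intro x hx
    refine intervalIntegral.integral_hasDerivAt_right ?_ ?_ ?_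
    · apply ContinuousOn.intervalIntegrable
      rw [uIcc_of_le hx.1.le]
      exact cga.mono (Icc_subset_Icc le_rfl hx.2.le)
    · exact (cga.mono Ioo_subset_Icc_self).stronglyMeasurableAtFilter isOpen_Ioo x hx
    · exact cga.continuousAt (Icc_mem_nhds hx.1 hx.2)
  have dB : ∀ x ∈ Ioo (0:ℝ) 1, HasDerivAt B (-(g x * b x)) x := by
    intro x hx
    refine intervalIntegral.integral_hasDerivAt_left ?_ ?_ ?_
    · apply ContinuousOn.intervalIntegrable
      rw [uIcc_of_le hx.2.le]
      exact cgb.mono (Icc_subset_Icc hx.1.le le_rfl)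
    · exact (cgb.mono Ioo_subset_Icc_self).stronglyMeasurableAtFilter isOpen_Ioo x hx
    · exact cgb.continuousAt (Icc_mem_nhds hx.1 hx.2)
  refine ⟨fun x => W⁻¹ * (b x * A x + a x * B x), fun x => W⁻¹ * (b' x * A x + a' x * B x),
    ⟨by fun_prop, by fun_prop, ?_, ?_⟩, ?_, ?_⟩
  · intro x hx
    convert! (((hb.d x hx).mul (dA x hx)).add ((ha.d x hx).mul (dB x hx))).const_mul W⁻¹ using 1
    ring
  · intro x hx
    convert! (((hb.d' x hx).mul (dA x hx)).add ((ha.d' x hx).mul (dB x hx))).const_mul W⁻¹ using 1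
    have h1 : W⁻¹ * W = 1 := inv_mul_cancel₀ hW0
    have h2 := hW x (Ioo_subset_Icc_self hx)
    linear_combination (-(g x)) * h1 + g x * W⁻¹ * h2
  · simp [hA, ha0]
  · simp [hB, hb1]

abbrev AuxI := (Icc (0:ℝ) 1)
noncomputable abbrev AuxH := MeasureTheory.Lp ℂ 2 (MeasureTheory.volume : MeasureTheory.Measure AuxI)

noncomputable def auxL (F : ℝ → ℂ) (hF : ContinuousOn F (Icc (0:ℝ) 1)) : AuxH :=
  ContinuousMap.toLp 2 MeasureTheory.volume ℂ
    (⟨(Icc (0:ℝ) 1).domRestrict F, hF.domRestrict⟩ : C(AuxI, ℂ))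

theorem aux_integral (F : ℝ → ℂ) : ∫ x : AuxI, F x = ∫ x in (0:ℝ)..1, F x := by
  rw [MeasureTheory.integral_subtype measurableSet_Icc, MeasureTheory.integral_Icc_eq_integral_Ioc,
    intervalIntegral.integral_of_le zero_le_one]

theorem auxL_inner (F G : ℝ → ℂ) (hF : ContinuousOn F (Icc (0:ℝ) 1))
    (hG : ContinuousOn G (Icc (0:ℝ) 1)) :
    inner ℂ (auxL F hF) (auxL G hG) = ∫ x in (0:ℝ)..1, G x * star (F x) := by
  rw [auxL, auxL, MeasureTheory.ContinuousMap.inner_toLp, ← aux_integral (fun x => G x * star (F x))]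
  rfl

theorem auxL_exists (f : C(AuxI, ℂ)) : ∃ (F : ℝ → ℂ) (hF : ContinuousOn F (Icc (0:ℝ) 1)),
    (∀ x : AuxI, F x = f x) ∧ auxL F hF = ContinuousMap.toLp 2 MeasureTheory.volume ℂ f := by
  refine ⟨IccExtend zero_le_one f, (f.continuous.Icc_extend').continuousOn, ?_, ?_⟩
  · intro x; simp
  · rw [auxL]; congr 1; ext x; simp [domRestrict]

theorem auxL_congr (F G : ℝ → ℂ) (hF : ContinuousOn F (Icc (0:ℝ) 1))
    (hG : ContinuousOn G (Icc (0:ℝ) 1)) (h : ∀ x ∈ Icc (0:ℝ) 1, F x = G x) :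
    auxL F hF = auxL G hG := by
  rw [auxL, auxL]; congr 1; ext x; exact h x x.2

theorem auxL_smul (c : ℂ) (F : ℝ → ℂ) (hF : ContinuousOn F (Icc (0:ℝ) 1)) :
    auxL (fun x => c * F x) (continuousOn_const.mul hF) = c • auxL F hF := by
  rw [auxL, auxL, ← map_smul]; congr 1

theorem auxL_norm_sub (F G : ℝ → ℂ) (hF : ContinuousOn F (Icc (0:ℝ) 1))
    (hG : ContinuousOn G (Icc (0:ℝ) 1)) :
    auxL F hF - auxL G hG = auxL (fun x => F x - G x) (hF.sub hG) := by
  rw [auxL, auxL, auxL, ← map_sub]; congr 1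

noncomputable def auxK (W : ℂ) (a b : ℝ → ℂ) (ha : ContinuousOn a (Icc (0:ℝ) 1))
    (hb : ContinuousOn b (Icc (0:ℝ) 1)) : C(AuxI × AuxI, ℂ) :=
  ⟨fun p => W⁻¹ * ((Icc (0:ℝ) 1).domRestrict a (min p.1 p.2) *
    (Icc (0:ℝ) 1).domRestrict b (max p.1 p.2)), by
    have h1 : Continuous fun p : AuxI × AuxI => (Icc (0:ℝ) 1).domRestrict a (min p.1 p.2) :=
      ha.domRestrict.comp (by fun_prop)
    have h2 : Continuous fun p : AuxI × AuxI => (Icc (0:ℝ) 1).domRestrict b (max p.1 p.2) :=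
      hb.domRestrict.comp (by fun_prop)
    exact continuous_const.mul (h1.mul h2)⟩

noncomputable def auxg (W : ℂ) (a b : ℝ → ℂ) (ha : ContinuousOn a (Icc (0:ℝ) 1))
    (hb : ContinuousOn b (Icc (0:ℝ) 1)) : C(AuxI, AuxH) :=
  ⟨fun x => ContinuousMap.toLp 2 MeasureTheory.volume ℂ ((auxK W a b ha hb).curry x), by
    fun_prop⟩

noncomputable def auxT (W : ℂ) (a b : ℝ → ℂ) (ha : ContinuousOn a (Icc (0:ℝ) 1))
    (hb : ContinuousOn b (Icc (0:ℝ) 1)) : AuxH →L[ℂ] AuxH :=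
  (BoundedContinuousFunction.toLp 2 MeasureTheory.volume ℂ).comp (auxS (auxg W a b ha hb))

theorem auxT_compact (W : ℂ) (a b : ℝ → ℂ) (ha : ContinuousOn a (Icc (0:ℝ) 1))
    (hb : ContinuousOn b (Icc (0:ℝ) 1)) : IsCompactOperator (auxT W a b ha hb) :=
  (auxS_compact (auxg W a b ha hb)).clm_comp
    (BoundedContinuousFunction.toLp 2 MeasureTheory.volume ℂ)

theorem auxT_eq (W : ℂ) (a b : ℝ → ℂ) (ha : ContinuousOn a (Icc (0:ℝ) 1))
    (hb : ContinuousOn b (Icc (0:ℝ) 1)) (f : AuxH) :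
    ∃ (F : ℝ → ℂ) (hF : ContinuousOn F (Icc (0:ℝ) 1)),
      (∀ x : AuxI, F x = auxS (auxg W a b ha hb) f x) ∧ auxT W a b ha hb f = auxL F hF := by
  obtain ⟨F, hF, h1, h2⟩ := auxL_exists (auxS (auxg W a b ha hb) f).toContinuousMap
  exact ⟨F, hF, h1, by rw [h2]; rfl⟩

theorem auxS_formula (W : ℂ) (a b : ℝ → ℂ) (ha : ContinuousOn a (Icc (0:ℝ) 1))
    (hb : ContinuousOn b (Icc (0:ℝ) 1)) (hWr : star W = W)
    (har : ∀ x ∈ Icc (0:ℝ) 1, star (a x) = a x) (hbr : ∀ x ∈ Icc (0:ℝ) 1, star (b x) = b x)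
    (F : ℝ → ℂ) (hF : ContinuousOn F (Icc (0:ℝ) 1)) (x : AuxI) :
    auxS (auxg W a b ha hb) (auxL F hF) x = W⁻¹ * (b x * (∫ t in (0:ℝ)..x, F t * a t) +
      a x * (∫ t in (x:ℝ)..1, F t * b t)) := by
  have h1 : auxS (auxg W a b ha hb) (auxL F hF) x =
      ∫ y : AuxI, F y * star (W⁻¹ * (a (min (x:ℝ) y) * b (max (x:ℝ) y))) := by
    rw [auxS_apply]
    change inner ℂ (ContinuousMap.toLp 2 MeasureTheory.volume ℂ ((auxK W a b ha hb).curry x))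
      (auxL F hF) = _
    rw [auxL, MeasureTheory.ContinuousMap.inner_toLp]
    rfl
  have hx := x.2
  have hmin : ContinuousOn (fun t : ℝ => a (min (x:ℝ) t)) (Icc (0:ℝ) 1) :=
    ha.comp (by fun_prop) (fun t ht => ⟨le_min hx.1 ht.1, (min_le_left _ _).trans hx.2⟩)
  have hmax : ContinuousOn (fun t : ℝ => b (max (x:ℝ) t)) (Icc (0:ℝ) 1) :=
    hb.comp (by fun_prop) (fun t ht => ⟨hx.1.trans (le_max_left _ _), max_le hx.2 ht.2⟩)
  have hcont : ContinuousOn (fun t : ℝ => F t * star (W⁻¹ * (a (min (x:ℝ) t) * b (max (x:ℝ) t))))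
      (Icc (0:ℝ) 1) := hF.mul (continuousOn_const.mul (hmin.mul hmax)).star
  rw [h1, aux_integral (fun y => F y * star (W⁻¹ * (a (min (x:ℝ) y) * b (max (x:ℝ) y)))),
    ← intervalIntegral.integral_add_adjacent_intervals (b := (x:ℝ)), mul_add]
  · congr 1
    · rw [← intervalIntegral.integral_const_mul, ← intervalIntegral.integral_const_mul]
      apply intervalIntegral.integral_congr
      intro t ht
      rw [uIcc_of_le hx.1] at ht
      have ht' : t ∈ Icc (0:ℝ) 1 := ⟨ht.1, ht.2.trans hx.2⟩
      simp only [min_eq_right ht.2, max_eq_left ht.2, star_mul', star_inv₀, hWr, har t ht',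
        hbr _ hx]
      ring
    · rw [← intervalIntegral.integral_const_mul, ← intervalIntegral.integral_const_mul]
      apply intervalIntegral.integral_congr
      intro t ht
      rw [uIcc_of_le hx.2] at ht
      have ht' : t ∈ Icc (0:ℝ) 1 := ⟨hx.1.trans ht.1, ht.2⟩
      simp only [min_eq_left ht.1, max_eq_right ht.1, star_mul', star_inv₀, hWr, har _ hx,
        hbr t ht']
      ring
  · apply ContinuousOn.intervalIntegrable
    rw [uIcc_of_le hx.1]
    exact hcont.mono (Icc_subset_Icc le_rfl hx.2)
  · apply ContinuousOn.intervalIntegrable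
    rw [uIcc_of_le hx.2]
    exact hcont.mono (Icc_subset_Icc hx.1 le_rfl)

/-- hypotheses on the two solutions at energy zero -/
structure AuxPair (q : ℝ → ℝ) (W : ℂ) (a a' b b' : ℝ → ℂ) : Prop where
  ha : AuxSol q (fun _ => 0) a a'
  hb : AuxSol q (fun _ => 0) b b'
  ha0 : a 0 = 0
  hb1 : b 1 = 0
  hW : ∀ x ∈ Icc (0:ℝ) 1, W = a x * b' x - a' x * b x
  hW0 : W ≠ 0
  hWr : star W = W
  har : ∀ x ∈ Icc (0:ℝ) 1, star (a x) = a x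
  hbr : ∀ x ∈ Icc (0:ℝ) 1, star (b x) = b x

theorem AuxPair.S_eq {q : ℝ → ℝ} {W : ℂ} {a a' b b' g u u' : ℝ → ℂ}
    (P : AuxPair q W a a' b b') (hg : ContinuousOn g (Icc (0:ℝ) 1)) (hu : AuxSol q g u u')
    (h0 : u 0 = 0) (h1 : u 1 = 0) (x : AuxI) :
    auxS (auxg W a b P.ha.cu P.hb.cu) (auxL g hg) x = u x := by
  rw [auxS_formula W a b _ _ P.hWr P.har P.hbr, ← P.ha.rep P.hb P.ha0 P.hb1 P.hW hg hu h0 h1 x x.2]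
  have := P.hW0
  field_simp

theorem AuxPair.T_eq {q : ℝ → ℝ} {W : ℂ} {a a' b b' g u u' : ℝ → ℂ}
    (P : AuxPair q W a a' b b') (hg : ContinuousOn g (Icc (0:ℝ) 1)) (hu : AuxSol q g u u')
    (h0 : u 0 = 0) (h1 : u 1 = 0) :
    auxT W a b P.ha.cu P.hb.cu (auxL g hg) = auxL u hu.cu := by
  obtain ⟨F, hF, e1, e2⟩ := auxT_eq W a b P.ha.cu P.hb.cu (auxL g hg)
  rw [e2]
  apply auxL_congr
  intro x hx
  rw [e1 ⟨x, hx⟩, P.S_eq hg hu h0 h1]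

theorem AuxPair.symm {q : ℝ → ℝ} {W : ℂ} {a a' b b' : ℝ → ℂ}
    (P : AuxPair q W a a' b b') : (auxT W a b P.ha.cu P.hb.cu).IsSymmetric := by
  have hdense : DenseRange (ContinuousMap.toLp 2 MeasureTheory.volume ℂ : C(AuxI, ℂ) →L[ℂ] AuxH) :=
    ContinuousMap.toLp_denseRange ℂ MeasureTheory.volume ℂ (by norm_num)
  intro f h
  change inner ℂ (auxT W a b P.ha.cu P.hb.cu f) h = inner ℂ f (auxT W a b P.ha.cu P.hb.cu h)
  refine hdense.induction_on₂ (p := fun f h => inner ℂ (auxT W a b P.ha.cu P.hb.cu f) h =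
    inner ℂ f (auxT W a b P.ha.cu P.hb.cu h)) ?_ ?_ f h
  · exact isClosed_eq (by fun_prop) (by fun_prop)
  · intro f h
    obtain ⟨F, hF, -, hF2⟩ := auxL_exists f
    obtain ⟨G, hG, -, hG2⟩ := auxL_exists h
    rw [← hF2, ← hG2]
    obtain ⟨u, u', hu, hu0, hu1⟩ := aux_exists_sol P.ha P.hb P.ha0 P.hb1 P.hW P.hW0 hF
    obtain ⟨v, v', hv, hv0, hv1⟩ := aux_exists_sol P.ha P.hb P.ha0 P.hb1 P.hW P.hW0 hG
    rw [P.T_eq hF hu hu0 hu1, P.T_eq hG hv hv0 hv1, auxL_inner, auxL_inner]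
    have hgr := hv.green hu.conj hG hF.star le_rfl zero_le_one le_rfl
    simp only [hu0, hu1, hv0, hv1, star_zero, mul_zero, zero_mul, sub_zero] at hgr
    rw [intervalIntegral.integral_sub] at hgr
    · exact sub_eq_zero.1 hgr
    · apply ContinuousOn.intervalIntegrable
      rw [uIcc_of_le zero_le_one]
      exact hG.mul hu.cu.star
    · apply ContinuousOn.intervalIntegrable
      rw [uIcc_of_le zero_le_one]
      exact hv.cu.mul hF.star

theorem AuxPair.eigen {q : ℝ → ℝ} {W : ℂ} {a a' b b' : ℝ → ℂ}
    (P : AuxPair q W a a' b b') (κ : ℂ) (hκ : κ ≠ 0) (f : AuxH)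
    (hf : auxT W a b P.ha.cu P.hb.cu f = κ • f) :
    ∃ u u', ∃ hu : AuxSol q (fun x => κ⁻¹ * u x) u u', u 0 = 0 ∧ u 1 = 0 ∧
      f = κ⁻¹ • auxL u hu.cu := by
  obtain ⟨F, hF, e1, e2⟩ := auxT_eq W a b P.ha.cu P.hb.cu f
  have hf' : f = auxL (fun x => κ⁻¹ * F x) (continuousOn_const.mul hF) := by
    rw [auxL_smul κ⁻¹ F hF, ← e2, hf, smul_smul, inv_mul_cancel₀ hκ, one_smul]
  have hcF : ContinuousOn (fun x => κ⁻¹ * F x) (Icc (0:ℝ) 1) := continuousOn_const.mul hF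
  obtain ⟨u, u', hu, hu0, hu1⟩ := aux_exists_sol P.ha P.hb P.ha0 P.hb1 P.hW P.hW0 hcF
  have huF : ∀ x ∈ Icc (0:ℝ) 1, F x = u x := by
    intro x hx
    rw [e1 ⟨x, hx⟩, hf', P.S_eq hcF hu hu0 hu1]
  refine ⟨u, u', hu.congr (fun x hx => by rw [huF x hx]), hu0, hu1, ?_⟩
  rw [hf', auxL_smul κ⁻¹ F hF, auxL_congr F u hF hu.cu huF]

/-- `b` lies in the closure of the range of the Green operator. -/
theorem AuxPair.mem_closure {q : ℝ → ℝ} {W : ℂ} {a a' b b' : ℝ → ℂ}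
    (P : AuxPair q W a a' b b') :
    auxL b P.hb.cu ∈ closure (range (auxT W a b P.ha.cu P.hb.cu)) := by
  have hcb := P.hb.cu
  have hcb' := P.hb.cu'
  obtain ⟨C, hC⟩ := isCompact_Icc.exists_bound_of_continuousOn hcb
  have hsol : ∀ n : ℕ, AuxSol q
      (fun x => 2 * b' x * ((n+2) * (1 - (x:ℂ)) ^ (n+1)) -
        b x * ((n+2) * (n+1) * (1 - (x:ℂ)) ^ n))
      (fun x => b x * (1 - (1 - (x:ℂ)) ^ (n+2)))
      (fun x => b' x * (1 - (1 - (x:ℂ)) ^ (n+2)) + b x * ((n+2) * (1 - (x:ℂ)) ^ (n+1))) := by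
    intro n
    have hd : ∀ (m : ℕ) (x : ℝ), HasDerivAt (fun x : ℝ => (1 - (x:ℂ)) ^ (m+1))
        (-((m+1) * (1 - (x:ℂ)) ^ m)) x := by
      intro m x
      have := ((Complex.ofRealCLM.hasDerivAt (x := x)).const_sub 1).pow (m+1)
      convert! this using 1
      simp
    refine ⟨by fun_prop, by fun_prop, ?_, ?_⟩
    · intro x hx
      convert! (P.hb.d x hx).mul ((hd (n+1) x).const_sub 1) using 1
      push_cast; ring
    · intro x hx
      convert! ((P.hb.d' x hx).mul ((hd (n+1) x).const_sub 1)).add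
        ((P.hb.d x hx).mul ((hd n x).const_mul ((n:ℂ)+2))) using 1
      push_cast; ring
  apply mem_closure_of_tendsto (f := fun n : ℕ => auxL _ (hsol n).cu) (b := atTop)
  · rw [tendsto_iff_norm_sub_tendsto_zero]
    have key : ∀ n : ℕ, ‖auxL _ (hsol n).cu - auxL b P.hb.cu‖ ^ 2 ≤ C ^ 2 * (1 / ((n:ℝ) + 1)) := by
      intro n
      rw [auxL_norm_sub, ← inner_self_eq_norm_sq (𝕜 := ℂ), auxL_inner]
      refine (Complex.re_le_norm _).trans ?_
      have hintg : ∫ x in (0:ℝ)..1, C ^ 2 * x ^ n = C ^ 2 * (1 / ((n:ℝ) + 1)) := by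
        rw [intervalIntegral.integral_const_mul, integral_pow]; simp
      have hintg' : ∫ x in (0:ℝ)..1, C ^ 2 * (1 - x) ^ n = C ^ 2 * (1 / ((n:ℝ) + 1)) := by
        rw [← hintg, intervalIntegral.integral_comp_sub_left (fun x => C ^ 2 * x ^ n)]; simp
      rw [← hintg']
      refine intervalIntegral.norm_integral_le_of_norm_le zero_le_one ?_
        (Continuous.intervalIntegrable (by fun_prop) _ _)
      refine Eventually.of_forall fun x hx => ?_
      have hx' : x ∈ Icc (0:ℝ) 1 := ⟨hx.1.le, hx.2⟩
      have h1 : b x * (1 - (1 - (x:ℂ)) ^ (n+2)) - b x = -(b x * (1 - (x:ℂ)) ^ (n+2)) := by ring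
      have h2 : ‖1 - (x:ℂ)‖ = 1 - x := by
        rw [← Complex.ofReal_one, ← Complex.ofReal_sub, Complex.norm_real, Real.norm_eq_abs,
          abs_of_nonneg (by linarith [hx.2])]
      rw [h1, norm_mul, norm_star, norm_neg, norm_mul, norm_pow, h2]
      have h3 := hC x hx'
      have h4 : (1 - x) ^ (n+2) * (1 - x) ^ (n+2) ≤ (1 - x) ^ n := by
        rw [← pow_add]
        exact pow_le_pow_of_le_one (by linarith [hx.2]) (by linarith [hx.1]) (by omega)
      have h5 : ‖b x‖ * ‖b x‖ ≤ C ^ 2 := by nlinarith [norm_nonneg (b x)]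
      calc ‖b x‖ * (1 - x) ^ (n+2) * (‖b x‖ * (1 - x) ^ (n+2))
          = (‖b x‖ * ‖b x‖) * ((1 - x) ^ (n+2) * (1 - x) ^ (n+2)) := by ring
        _ ≤ C ^ 2 * (1 - x) ^ n := by
          apply mul_le_mul h5 h4 _ (by positivity)
          exact mul_self_nonneg _
    have hlim : Tendsto (fun n : ℕ => C ^ 2 * (1 / ((n:ℝ) + 1))) atTop (nhds 0) := by
      simpa using (tendsto_one_div_add_atTop_nhds_zero_nat (𝕜 := ℝ)).const_mul (C ^ 2)
    have hsq := squeeze_zero (fun n => by positivity) key hlim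
    have := hsq.sqrt
    simpa [Real.sqrt_sq (norm_nonneg _)] using this
  · refine Eventually.of_forall fun n => ?_
    have hg : ContinuousOn (fun x : ℝ => 2 * b' x * ((n+2) * (1 - (x:ℂ)) ^ (n+1)) -
        b x * ((n+2) * (n+1) * (1 - (x:ℂ)) ^ n)) (Icc (0:ℝ) 1) := by fun_prop
    exact ⟨auxL _ hg, P.T_eq hg (hsol n) (by simp) (by simp [P.hb1])⟩

theorem AuxSol.zero0 {q : ℝ → ℝ} {z : ℂ} {c c' s s' u u' : ℝ → ℂ}
    (hc : AuxSol q (fun x => z * c x) c c') (hs : AuxSol q (fun x => z * s x) s s')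
    (hW : c 0 * s' 0 - c' 0 * s 0 = 1)
    (hu : AuxSol q (fun x => z * u x) u u') (h1 : u 0 = 0) (h1' : u' 0 = 0) :
    ∀ x ∈ Icc (0:ℝ) 1, u x = 0 := by
  intro x hx
  have e1 := hu.wron hc le_rfl hx.1 hx.2
  have e2 := hu.wron hs le_rfl hx.1 hx.2
  have e3 := hc.wron hs le_rfl hx.1 hx.2
  rw [h1, h1'] at e1 e2
  have e4 : c x * s' x - c' x * s x = 1 := by linear_combination hW - e3
  linear_combination (-(u x)) * e4 - c x * e2 + s x * e1

theorem AuxSol.prop {q : ℝ → ℝ} {z : ℂ} {c c' s s' φ φ' u u' : ℝ → ℂ}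
    (hc : AuxSol q (fun x => z * c x) c c') (hs : AuxSol q (fun x => z * s x) s s')
    (hW : c 0 * s' 0 - c' 0 * s 0 = 1)
    (hφ : AuxSol q (fun x => z * φ x) φ φ') (hφ1 : φ 1 = 0) (hφ1' : φ' 1 = 1)
    (hu : AuxSol q (fun x => z * u x) u u') (h1 : u 1 = 0) :
    ∀ x ∈ Icc (0:ℝ) 1, u x = u' 1 * φ x := by
  intro x hx
  have h := hu.lin hφ (u' 1)
  have h' := h.congr (h := fun x => z * (u x - u' 1 * φ x)) (fun x _ => by ring)
  have := AuxSol.zero hc hs hW h' (by simp [h1, hφ1]) (by simp [hφ1']) x hx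
  exact sub_eq_zero.1 this

theorem aux_pert {q : ℝ → ℝ} {w : ℂ} {c c' s s' φ φ' : ℝ → ℂ}
    (hc : AuxSol q (fun x => w * c x) c c') (hs : AuxSol q (fun x => w * s x) s s')
    (hW : c 0 * s' 0 - c' 0 * s 0 = 1)
    (hφ : AuxSol q (fun x => w * φ x) φ φ') (hφ1 : φ 1 = 0) (hφ1' : φ' 1 = 1) :
    ∃ K : ℝ, ∀ (z : ℂ) (u u' : ℝ → ℂ), AuxSol q (fun x => z * u x) u u' → u 1 = 0 →
      u' 1 = 1 → ‖z - w‖ * K ≤ 1 → ∀ x ∈ Icc (0:ℝ) 1, ‖u x - φ x‖ ≤ K * ‖z - w‖ := by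
  obtain ⟨C1, hC1⟩ := isCompact_Icc.exists_bound_of_continuousOn hc.cu
  obtain ⟨C2, hC2⟩ := isCompact_Icc.exists_bound_of_continuousOn hs.cu
  obtain ⟨B, hB⟩ := isCompact_Icc.exists_bound_of_continuousOn hφ.cu
  have m0 : (0:ℝ) ∈ Icc (0:ℝ) 1 := ⟨le_rfl, zero_le_one⟩
  have hC1' : 0 ≤ C1 := (norm_nonneg _).trans (hC1 0 m0)
  have hC2' : 0 ≤ C2 := (norm_nonneg _).trans (hC2 0 m0)
  have hB' : 0 ≤ B := (norm_nonneg _).trans (hB 0 m0)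
  have key : ∀ (z : ℂ) (u u' : ℝ → ℂ), AuxSol q (fun x => z * u x) u u' → u 1 = 0 →
      u' 1 = 1 → ∀ x ∈ Icc (0:ℝ) 1, u x = s x * c 1 - c x * s 1 -
        (z - w) * (s x * (∫ t in x..1, u t * c t) - c x * (∫ t in x..1, u t * s t)) := by
    intro z u u' hu h1 h1' x hx
    have e1 := hu.green hc (continuousOn_const.mul hu.cu) (continuousOn_const.mul hc.cu)
      hx.1 hx.2 le_rfl
    have e2 := hu.green hs (continuousOn_const.mul hu.cu) (continuousOn_const.mul hs.cu)
      hx.1 hx.2 le_rfl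
    have r1 : ∀ t, z * u t * c t - u t * (w * c t) = (z - w) * (u t * c t) := fun t => by ring
    have r2 : ∀ t, z * u t * s t - u t * (w * s t) = (z - w) * (u t * s t) := fun t => by ring
    simp only [r1, r2, intervalIntegral.integral_const_mul, h1, h1'] at e1 e2
    have e3 := hc.wron hs le_rfl hx.1 hx.2
    have e4 : c x * s' x - c' x * s x = 1 := by linear_combination hW - e3
    linear_combination (-(u x)) * e4 + s x * e1 - c x * e2
  refine ⟨4 * (C1 * C2) * B + 4 * (C1 * C2), ?_⟩
  intro z u u' hu h1 h1' hz x hx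
  obtain ⟨x₀, hx₀, hmax⟩ := isCompact_Icc.exists_isMaxOn ⟨(0:ℝ), m0⟩ hu.cu.norm
  have hU : ∀ t ∈ Icc (0:ℝ) 1, ‖u t‖ ≤ ‖u x₀‖ := fun t ht => hmax ht
  set U := ‖u x₀‖ with hUdef
  have hU0 : 0 ≤ U := norm_nonneg _
  have hintg : ∀ (C : ℝ) (f : ℝ → ℂ), (∀ t ∈ Icc (0:ℝ) 1, ‖f t‖ ≤ C) → ∀ y ∈ Icc (0:ℝ) 1,
      ‖∫ t in y..1, u t * f t‖ ≤ U * C := by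
    intro C f hf y hy
    have hC : 0 ≤ C := (norm_nonneg _).trans (hf 0 m0)
    have := intervalIntegral.norm_integral_le_of_norm_le_const (a := y) (b := 1) (C := U * C)
      (f := fun t => u t * f t) ?_
    · refine this.trans ?_
      rw [abs_of_nonneg (by linarith [hy.2])]
      have : 1 - y ≤ 1 := by linarith [hy.1]
      exact mul_le_of_le_one_right (by positivity) this
    · intro t ht
      rw [uIoc_of_le hy.2] at ht
      have ht' : t ∈ Icc (0:ℝ) 1 := ⟨hy.1.trans ht.1.le, ht.2⟩
      rw [norm_mul]
      exact mul_le_mul (hU t ht') (hf t ht') (norm_nonneg _) hU0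
  have hdiff : ∀ y ∈ Icc (0:ℝ) 1, ‖u y - φ y‖ ≤ ‖z - w‖ * (2 * (C1 * C2) * U) := by
    intro y hy
    have k1 := key z u u' hu h1 h1' y hy
    have k2 := key w φ φ' hφ hφ1 hφ1' y hy
    have k3 : u y - φ y = -((z - w) * (s y * (∫ t in y..1, u t * c t) -
        c y * (∫ t in y..1, u t * s t))) := by
      rw [k2]
      linear_combination k1
    rw [k3, norm_neg, norm_mul]
    refine mul_le_mul_of_nonneg_left ?_ (norm_nonneg _)
    refine (norm_sub_le _ _).trans ?_
    rw [norm_mul, norm_mul]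
    have i1 := mul_le_mul (hC2 y hy) (hintg C1 c hC1 y hy) (norm_nonneg _) hC2'
    have i2 := mul_le_mul (hC1 y hy) (hintg C2 s hC2 y hy) (norm_nonneg _) hC1'
    linarith
  have hCC : 0 ≤ C1 * C2 := mul_nonneg hC1' hC2'
  have hzz : ‖z - w‖ * (4 * (C1 * C2)) ≤ 1 := by
    have : 0 ≤ ‖z - w‖ * (4 * (C1 * C2) * B) := by positivity
    linarith
  have hUB : U ≤ 2 * B := by
    have h3 : U ≤ ‖φ x₀‖ + ‖u x₀ - φ x₀‖ := by
      rw [hUdef]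
      calc ‖u x₀‖ = ‖φ x₀ + (u x₀ - φ x₀)‖ := by congr 1; ring
        _ ≤ _ := norm_add_le _ _
    have h4 := hdiff x₀ hx₀
    have h5 := hB x₀ hx₀
    have h6 : ‖z - w‖ * (2 * (C1 * C2) * U) ≤ U / 2 := by nlinarith
    linarith
  refine (hdiff x hx).trans ?_
  have h7 : 2 * (C1 * C2) * U ≤ 4 * (C1 * C2) * B := by nlinarith
  have h8 := mul_le_mul_of_nonneg_left h7 (norm_nonneg (z - w))
  nlinarith [norm_nonneg (z - w), mul_nonneg (norm_nonneg (z - w)) hCC]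

/-- continuity of integrals in the spectral parameter -/
theorem aux_tendsto {q : ℝ → ℝ} {ν : ℂ} {c c' s s' : ℝ → ℂ} {S S' : ℂ → ℝ → ℂ}
    (hc : AuxSol q (fun x => ν ^ 2 * c x) c c') (hs : AuxSol q (fun x => ν ^ 2 * s x) s s')
    (hW : c 0 * s' 0 - c' 0 * s 0 = 1)
    (hS : ∀ μ, AuxSol q (fun x => μ ^ 2 * S μ x) (S μ) (S' μ)) (hS1 : ∀ μ, S μ 1 = 0)
    (hS1' : ∀ μ, S' μ 1 = 1) (h : ℝ → ℂ) (hh : ContinuousOn h (Icc (0:ℝ) 1)) :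
    Tendsto (fun μ => ∫ t in (0:ℝ)..1, S μ t * h t) (nhds ν)
      (nhds (∫ t in (0:ℝ)..1, S ν t * h t)) := by
  obtain ⟨K, hK⟩ := aux_pert hc hs hW (hS ν) (hS1 ν) (hS1' ν)
  obtain ⟨C, hC⟩ := isCompact_Icc.exists_bound_of_continuousOn hh
  have hlim : Tendsto (fun μ : ℂ => ‖μ ^ 2 - ν ^ 2‖) (nhds ν) (nhds 0) := by
    have : Continuous fun μ : ℂ => ‖μ ^ 2 - ν ^ 2‖ := by fun_prop
    simpa using this.tendsto ν
  have hev : ∀ᶠ μ in nhds ν, ‖μ ^ 2 - ν ^ 2‖ * K ≤ 1 := by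
    have h2 := hlim.mul_const K
    rw [zero_mul] at h2
    exact (h2.eventually (gt_mem_nhds zero_lt_one)).mono fun _ h => le_of_lt h
  rw [tendsto_iff_norm_sub_tendsto_zero]
  have h3 := hlim.const_mul (K * C)
  have h3' : Tendsto (fun μ : ℂ => K * ‖μ ^ 2 - ν ^ 2‖ * C) (nhds ν) (nhds 0) := by
    rw [mul_zero] at h3
    exact h3.congr fun μ => by ring
  refine squeeze_zero' (Eventually.of_forall fun _ => norm_nonneg _) ?_ h3'
  filter_upwards [hev] with μ hμ
  have hii : ∀ μ, IntervalIntegrable (fun t => S μ t * h t) MeasureTheory.volume 0 1 := by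
    intro μ
    apply ContinuousOn.intervalIntegrable
    rw [uIcc_of_le zero_le_one]
    exact (hS μ).cu.mul hh
  rw [← intervalIntegral.integral_sub (hii μ) (hii ν)]
  have := intervalIntegral.norm_integral_le_of_norm_le_const (a := 0) (b := 1)
    (C := K * ‖μ ^ 2 - ν ^ 2‖ * C) (f := fun t => S μ t * h t - S ν t * h t) ?_
  · simpa using this
  · intro t ht
    rw [uIoc_of_le zero_le_one] at ht
    have ht' : t ∈ Icc (0:ℝ) 1 := ⟨ht.1.le, ht.2⟩
    rw [← sub_mul, norm_mul]
    have h4 := hK _ _ _ (hS μ) (hS1 μ) (hS1' μ) hμ t ht'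
    exact mul_le_mul h4 (hC t ht') (norm_nonneg _) ((norm_nonneg _).trans h4)

theorem auxL_eq_zero (F : ℝ → ℂ) (hF : ContinuousOn F (Icc (0:ℝ) 1)) (h : auxL F hF = 0) :
    ∀ x ∈ Icc (0:ℝ) 1, F x = 0 := by
  intro x hx
  by_contra hne
  have h1 := auxL_inner F F hF hF
  rw [h, inner_zero_left] at h1
  have h2 : ∀ t, F t * star (F t) = ((‖F t‖ ^ 2 : ℝ) : ℂ) := by
    intro t
    rw [Complex.star_def, Complex.mul_conj, Complex.normSq_eq_norm_sq]
  simp only [h2] at h1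
  rw [intervalIntegral.integral_ofReal] at h1
  have h3 : 0 < ∫ t in (0:ℝ)..1, ‖F t‖ ^ 2 :=
    intervalIntegral.integral_pos zero_lt_one (hF.norm.pow 2) (fun t _ => by positivity)
      ⟨x, hx, by positivity⟩
  exact h3.ne (by exact_mod_cast h1)

/-- Mittag-Leffler expansion of the Weyl–Titchmarsh function `M(μ²) = -D(μ²)/Δ(μ²)`:
`M(μ²) - M(0) = 2 Σ_k (Res(m;α_k)/α_k) · μ²/(μ² - α_k²)` away from the poles,
where `m(μ) = M(μ²)` has simple poles at `±α_k`, the `α_k²` being the (simple,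
nonzero) zeros of the characteristic function `Δ`. -/
theorem stmt_8
    (q : ℝ → ℝ)
    (hq : MeasureTheory.IntegrableOn q (Icc (0:ℝ) 1))
    (c₀ s₀ s₁ c₀' s₀' s₁' : ℂ → ℝ → ℂ)
    (hc₀ : ∀ μ : ℂ, ∀ x ∈ Icc (0:ℝ) 1, HasDerivAt (c₀ μ) (c₀' μ x) x)
    (hc₀' : ∀ μ : ℂ, ∀ x ∈ Icc (0:ℝ) 1,
      HasDerivAt (c₀' μ) (((q x : ℂ) + μ ^ 2) * c₀ μ x) x)
    (hs₀ : ∀ μ : ℂ, ∀ x ∈ Icc (0:ℝ) 1, HasDerivAt (s₀ μ) (s₀' μ x) x)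
    (hs₀' : ∀ μ : ℂ, ∀ x ∈ Icc (0:ℝ) 1,
      HasDerivAt (s₀' μ) (((q x : ℂ) + μ ^ 2) * s₀ μ x) x)
    (hs₁ : ∀ μ : ℂ, ∀ x ∈ Icc (0:ℝ) 1, HasDerivAt (s₁ μ) (s₁' μ x) x)
    (hs₁' : ∀ μ : ℂ, ∀ x ∈ Icc (0:ℝ) 1,
      HasDerivAt (s₁' μ) (((q x : ℂ) + μ ^ 2) * s₁ μ x) x)
    (hic : ∀ μ : ℂ, c₀ μ 0 = 1 ∧ c₀' μ 0 = 0 ∧ s₀ μ 0 = 0 ∧ s₀' μ 0 = 1 ∧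
      s₁ μ 1 = 0 ∧ s₁' μ 1 = 1)
    (Δ D : ℂ → ℂ)
    (hΔ : ∀ μ : ℂ, ∀ x ∈ Icc (0:ℝ) 1,
      Δ (μ ^ 2) = s₀ μ x * s₁' μ x - s₀' μ x * s₁ μ x)
    (hD : ∀ μ : ℂ, ∀ x ∈ Icc (0:ℝ) 1,
      D (μ ^ 2) = c₀ μ x * s₁' μ x - c₀' μ x * s₁ μ x)
    (α : ℕ → ℂ)
    (hα0 : ∀ k : ℕ, α k ≠ 0)
    (hzeros : ∀ k : ℕ, Δ (α k ^ 2) = 0)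
    (hall : ∀ z : ℂ, Δ z = 0 → ∃ k : ℕ, α k ^ 2 = z)
    (hinj : Function.Injective fun k : ℕ => α k ^ 2)
    (r : ℕ → ℂ)
    (hres : ∀ k : ℕ, Tendsto (fun μ : ℂ => (μ - α k) * (-(D (μ ^ 2)) / Δ (μ ^ 2)))
      (nhdsWithin (α k) {α k}ᶜ) (nhds (r k))) :
    ∀ μ : ℂ, (∀ k : ℕ, μ ^ 2 ≠ α k ^ 2) →
      HasSum (fun k : ℕ => 2 * (r k / α k) * (μ ^ 2 / (μ ^ 2 - α k ^ 2)))
        (-(D (μ ^ 2)) / Δ (μ ^ 2) - -(D 0) / Δ 0) := by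
  have m0 : (0:ℝ) ∈ Icc (0:ℝ) 1 := ⟨le_rfl, zero_le_one⟩
  have m1 : (1:ℝ) ∈ Icc (0:ℝ) 1 := ⟨zero_le_one, le_rfl⟩
  have mk : ∀ (z : ℂ) (u u' : ℝ → ℂ), (∀ x ∈ Icc (0:ℝ) 1, HasDerivAt u (u' x) x) →
      (∀ x ∈ Icc (0:ℝ) 1, HasDerivAt u' (((q x : ℂ) + z) * u x) x) →
      AuxSol q (fun x => z * u x) u u' := by
    intro z u u' h1 h2
    refine ⟨fun x hx => (h1 x hx).continuousAt.continuousWithinAt,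
      fun x hx => (h2 x hx).continuousAt.continuousWithinAt,
      fun x hx => h1 x (Ioo_subset_Icc_self hx), fun x hx => ?_⟩
    convert! h2 x (Ioo_subset_Icc_self hx) using 1
    ring
  have Sc : ∀ μ, AuxSol q (fun x => μ ^ 2 * c₀ μ x) (c₀ μ) (c₀' μ) :=
    fun μ => mk _ _ _ (hc₀ μ) (hc₀' μ)
  have Ss : ∀ μ, AuxSol q (fun x => μ ^ 2 * s₀ μ x) (s₀ μ) (s₀' μ) :=
    fun μ => mk _ _ _ (hs₀ μ) (hs₀' μ)
  have S1 : ∀ μ, AuxSol q (fun x => μ ^ 2 * s₁ μ x) (s₁ μ) (s₁' μ) :=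
    fun μ => mk _ _ _ (hs₁ μ) (hs₁' μ)
  have i1 : ∀ μ, s₁ μ 1 = 0 := fun μ => (hic μ).2.2.2.2.1
  have i1' : ∀ μ, s₁' μ 1 = 1 := fun μ => (hic μ).2.2.2.2.2
  have hW : ∀ μ, c₀ μ 0 * s₀' μ 0 - c₀' μ 0 * s₀ μ 0 = 1 := by
    intro μ
    obtain ⟨h1, h2, h3, h4, -, -⟩ := hic μ
    rw [h1, h2, h3, h4]; ring
  have vΔ : ∀ μ, Δ (μ ^ 2) = -s₁ μ 0 := by
    intro μ
    obtain ⟨h1, h2, h3, h4, -, -⟩ := hic μ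
    rw [hΔ μ 0 m0, h3, h4]; ring
  have vD : ∀ μ, D (μ ^ 2) = s₁' μ 0 := by
    intro μ
    obtain ⟨h1, h2, h3, h4, -, -⟩ := hic μ
    rw [hD μ 0 m0, h1, h2]; ring
  have z2 : (0:ℂ) ^ 2 = 0 := by norm_num
  have vΔ0 : Δ 0 = -s₁ 0 0 := by rw [← vΔ 0, z2]
  have vD0 : D 0 = s₁' 0 0 := by rw [← vD 0, z2]
  -- Green identities between the `s₁`
  have grn : ∀ μ ν, (μ ^ 2 - ν ^ 2) * (∫ t in (0:ℝ)..1, s₁ μ t * s₁ ν t) =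
      s₁ μ 0 * s₁' ν 0 - s₁' μ 0 * s₁ ν 0 := by
    intro μ ν
    have e := (S1 μ).green (S1 ν) (continuousOn_const.mul (S1 μ).cu)
      (continuousOn_const.mul (S1 ν).cu) le_rfl zero_le_one le_rfl
    have r1 : ∀ t, μ ^ 2 * s₁ μ t * s₁ ν t - s₁ μ t * (ν ^ 2 * s₁ ν t) =
        (μ ^ 2 - ν ^ 2) * (s₁ μ t * s₁ ν t) := fun t => by ring
    simp only [r1, intervalIntegral.integral_const_mul, i1, i1'] at e
    rw [e]; ring
  -- reality
  have real1 : ∀ μ, star (μ ^ 2) = μ ^ 2 → ∀ x ∈ Icc (0:ℝ) 1, star (s₁ μ x) = s₁ μ x := by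
    intro μ hμ x hx
    have h := (S1 μ).conj.congr (h := fun x => μ ^ 2 * star (s₁ μ x))
      (fun x _ => by rw [star_mul', hμ])
    have := AuxSol.prop (Sc μ) (Ss μ) (hW μ) (S1 μ) (i1 μ) (i1' μ) h (by simp [i1]) x hx
    simpa [i1'] using this
  have real0 : ∀ x ∈ Icc (0:ℝ) 1, star (s₀ 0 x) = s₀ 0 x := by
    intro x hx
    have h := ((Ss 0).conj.lin (Ss 0) 1).congr
      (h := fun x => (0:ℂ) ^ 2 * (star (s₀ 0 x) - 1 * s₀ 0 x)) (fun x _ => by simp)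
    obtain ⟨h1, h2, h3, h4, -, -⟩ := hic 0
    have := AuxSol.zero0 (Sc 0) (Ss 0) (hW 0) h (by simp [h3]) (by simp [h4]) x hx
    simpa [sub_eq_zero] using this
  have hΔ0 : Δ 0 ≠ 0 := by
    intro h
    obtain ⟨k, hk⟩ := hall 0 h
    exact hα0 k (by simpa using hk)
  have P : AuxPair q (Δ 0) (s₀ 0) (s₀' 0) (s₁ 0) (s₁' 0) :=
    { ha := (Ss 0).congr (fun x _ => by simp)
      hb := (S1 0).congr (fun x _ => by simp)
      ha0 := (hic 0).2.2.1
      hb1 := i1 0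
      hW := fun x hx => by rw [← hΔ 0 x hx, z2]
      hW0 := hΔ0
      hWr := by rw [vΔ0, star_neg, real1 0 (by simp) 0 m0]
      har := real0
      hbr := real1 0 (by simp) }
  -- eigenfunctions
  have φ0 : ∀ k, s₁ (α k) 0 = 0 := by
    intro k
    have := vΔ (α k)
    rw [hzeros k] at this
    exact neg_eq_zero.1 this.symm
  let L : ∀ μ, AuxH := fun μ => auxL (s₁ μ) (S1 μ).cu
  have L0 : ∀ μ, L μ ≠ 0 := by
    intro μ h
    have hz := auxL_eq_zero _ _ h
    have hmem : (1/2:ℝ) ∈ Icc (0:ℝ) 1 := by constructor <;> norm_num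
    have hd := hs₁ μ (1/2) hmem
    have hd0 : HasDerivAt (s₁ μ) 0 (1/2) := by
      refine (hasDerivAt_const (1/2:ℝ) (0:ℂ)).congr_of_eventuallyEq ?_
      filter_upwards [Icc_mem_nhds (show (0:ℝ) < 1/2 by norm_num) (show (1/2:ℝ) < 1 by norm_num)]
        with x hx using hz x hx
    have hd1 : s₁' μ (1/2) = 0 := hd.unique hd0
    have e1 := (S1 μ).wron (Sc μ) (x := 1/2) (y := 1) (by norm_num) (by norm_num) le_rfl
    have e2 := (S1 μ).wron (Ss μ) (x := 1/2) (y := 1) (by norm_num) (by norm_num) le_rfl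
    have e3 := (Sc μ).wron (Ss μ) (x := 0) (y := 1) le_rfl zero_le_one le_rfl
    rw [hd1, hz _ hmem, i1, i1'] at e1 e2
    have e4 := hW μ
    have e5 : c₀ μ 1 = 0 := by linear_combination e1
    have e6 : s₀ μ 1 = 0 := by linear_combination e2
    rw [e5, e6] at e3
    have : (1:ℂ) = 0 := by linear_combination e3 - e4
    exact one_ne_zero this
  have realα : ∀ k, star (α k ^ 2) = α k ^ 2 := by
    intro k
    have e := (S1 (α k)).green (S1 (α k)).conj (continuousOn_const.mul (S1 (α k)).cu)
      (continuousOn_const.mul (S1 (α k)).cu).star le_rfl zero_le_one le_rfl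
    have r1 : ∀ t, α k ^ 2 * s₁ (α k) t * star (s₁ (α k) t) -
        s₁ (α k) t * star (α k ^ 2 * s₁ (α k) t) =
        (α k ^ 2 - star (α k ^ 2)) * (s₁ (α k) t * star (s₁ (α k) t)) := fun t => by
      rw [star_mul']; ring
    simp only [r1, intervalIntegral.integral_const_mul, i1, φ0, star_zero, mul_zero, zero_mul,
      sub_zero] at e
    rw [← auxL_inner _ _ (S1 (α k)).cu (S1 (α k)).cu] at e
    rcases mul_eq_zero.1 e with h | h
    · exact (sub_eq_zero.1 h).symm
    · exact absurd (inner_self_eq_zero.1 h) (L0 (α k))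
  have realφ : ∀ k, ∀ x ∈ Icc (0:ℝ) 1, star (s₁ (α k) x) = s₁ (α k) x :=
    fun k => real1 _ (realα k)
  have innr : ∀ ν, (∀ x ∈ Icc (0:ℝ) 1, star (s₁ ν x) = s₁ ν x) → ∀ μ,
      inner ℂ (L ν) (L μ) = ∫ t in (0:ℝ)..1, s₁ μ t * s₁ ν t := by
    intro ν hν μ
    rw [auxL_inner]
    apply intervalIntegral.integral_congr
    intro t ht
    rw [uIcc_of_le zero_le_one] at ht
    simp only [hν t ht]
  have hN : ∀ k, ((‖L (α k)‖ : ℂ)) ^ 2 = ∫ t in (0:ℝ)..1, s₁ (α k) t * s₁ (α k) t := by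
    intro k
    rw [← innr _ (realφ k), inner_self_eq_norm_sq_to_K]
    rfl
  have hN0 : ∀ k, (‖L (α k)‖ : ℂ) ≠ 0 := by
    intro k
    exact_mod_cast norm_ne_zero_iff.2 (L0 (α k))
  let e : ℕ → AuxH := fun k => ((‖L (α k)‖ : ℂ))⁻¹ • L (α k)
  have he : Orthonormal ℂ e := by
    constructor
    · intro k
      have := norm_ne_zero_iff.2 (L0 (α k))
      simp only [e, norm_smul, norm_inv, Complex.norm_real, norm_norm]
      field_simp
    · intro k l hkl
      simp only [e, inner_smul_left, inner_smul_right]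
      rw [innr _ (realφ k)]
      have h := grn (α l) (α k)
      rw [φ0, φ0, zero_mul, mul_zero, sub_zero] at h
      rcases mul_eq_zero.1 h with h | h
      · exact absurd (hinj (sub_eq_zero.1 h)) (Ne.symm hkl)
      · rw [h]; simp
  have hE : ∀ κ : ℂ, κ ≠ 0 → ∀ f : AuxH,
      auxT (Δ 0) (s₀ 0) (s₁ 0) P.ha.cu P.hb.cu f = κ • f →
      f ∈ Submodule.span ℂ (range e) := by
    intro κ hκ f hf
    obtain ⟨u, u', hu, hu0, hu1, hfu⟩ := P.eigen κ hκ f hf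
    obtain ⟨μ, hμ⟩ := IsAlgClosed.exists_pow_nat_eq κ⁻¹ (n := 2) (by norm_num)
    rw [hfu]
    apply Submodule.smul_mem
    rw [← hμ] at hu
    have hp := AuxSol.prop (Sc μ) (Ss μ) (hW μ) (S1 μ) (i1 μ) (i1' μ) hu hu1
    by_cases h0 : u' 1 = 0
    · have : auxL u hu.cu = (0:ℂ) • L μ := by
        rw [← auxL_smul]
        apply auxL_congr
        intro x hx
        rw [hp x hx, h0]
      rw [this, zero_smul]
      exact Submodule.zero_mem _
    · have h1 : s₁ μ 0 = 0 := by
        have := hp 0 m0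
        rw [hu0] at this
        exact (mul_eq_zero.1 this.symm).resolve_left h0
      obtain ⟨k, hk⟩ := hall (μ ^ 2) (by rw [vΔ, h1, neg_zero])
      rw [← hk] at hu
      have hp' := AuxSol.prop (Sc (α k)) (Ss (α k)) (hW _) (S1 (α k)) (i1 _) (i1' _) hu hu1
      have : auxL u hu.cu = (u' 1 * ‖L (α k)‖) • e k := by
        simp only [e]
        rw [smul_smul, mul_assoc, mul_inv_cancel₀ (hN0 k), mul_one, ← auxL_smul]
        exact auxL_congr _ _ _ _ hp'
      rw [this]
      exact Submodule.smul_mem _ _ (Submodule.subset_span ⟨k, rfl⟩)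
  -- the residues
  have hφ' : ∀ k, s₁' (α k) 0 ≠ 0 := by
    intro k h
    refine L0 (α k) ?_
    have hz := AuxSol.zero0 (Sc (α k)) (Ss (α k)) (hW _) (S1 (α k)) (φ0 k) h
    have : L (α k) = (0:ℂ) • L (α k) := by
      rw [← auxL_smul]
      apply auxL_congr
      intro x hx
      rw [hz x hx, mul_zero]
    rw [this, zero_smul]
  have hr : ∀ k, 2 * α k * r k = s₁' (α k) 0 ^ 2 / (‖L (α k)‖ : ℂ) ^ 2 := by
    intro k
    set ν := α k with hν
    have t1 : Tendsto (fun μ => ∫ t in (0:ℝ)..1, s₁ μ t * s₁ ν t) (nhds ν)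
        (nhds ((‖L ν‖ : ℂ) ^ 2)) := by
      rw [hN k]
      exact aux_tendsto (Sc ν) (Ss ν) (hW ν) S1 i1 i1' _ (S1 ν).cu
    have t2 : Tendsto (fun μ => s₁' μ 0) (nhds ν) (nhds (s₁' ν 0)) := by
      have f1 : ∀ μ, s₁' μ 0 = c₀ ν 1 - (μ ^ 2 - ν ^ 2) * ∫ t in (0:ℝ)..1, s₁ μ t * c₀ ν t := by
        intro μ
        have g := (S1 μ).green (Sc ν) (continuousOn_const.mul (S1 μ).cu)
          (continuousOn_const.mul (Sc ν).cu) le_rfl zero_le_one le_rfl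
        have r1 : ∀ t, μ ^ 2 * s₁ μ t * c₀ ν t - s₁ μ t * (ν ^ 2 * c₀ ν t) =
            (μ ^ 2 - ν ^ 2) * (s₁ μ t * c₀ ν t) := fun t => by ring
        obtain ⟨h1, h2, -⟩ := hic ν
        simp only [r1, intervalIntegral.integral_const_mul, i1, i1', h1, h2] at g
        linear_combination g
      have f2 := aux_tendsto (Sc ν) (Ss ν) (hW ν) S1 i1 i1' _ (Sc ν).cu
      have f3 : Tendsto (fun μ : ℂ => μ ^ 2 - ν ^ 2) (nhds ν) (nhds (ν ^ 2 - ν ^ 2)) := by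
        have : Continuous fun μ : ℂ => μ ^ 2 - ν ^ 2 := by fun_prop
        exact this.tendsto ν
      have f4 := (f3.mul f2).const_sub (c₀ ν 1)
      rw [← f1 ν] at f4
      exact f4.congr fun μ => (f1 μ).symm
    have t3 : Tendsto (fun μ : ℂ => μ + ν) (nhdsWithin ν {ν}ᶜ) (nhds (ν + ν)) := by
      have : Continuous fun μ : ℂ => μ + ν := by fun_prop
      exact (this.tendsto ν).mono_left nhdsWithin_le_nhds
    have t4 := t3.mul (hres k)
    have hNν : (‖L ν‖ : ℂ) ^ 2 ≠ 0 := pow_ne_zero 2 (hN0 k)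
    have t5 : Tendsto (fun μ => s₁' μ 0 * s₁' ν 0 / ∫ t in (0:ℝ)..1, s₁ μ t * s₁ ν t)
        (nhdsWithin ν {ν}ᶜ) (nhds (s₁' ν 0 * s₁' ν 0 / (‖L ν‖ : ℂ) ^ 2)) :=
      ((t2.mul_const _).div t1 hNν).mono_left nhdsWithin_le_nhds
    have t6 : Tendsto (fun μ => s₁' μ 0 * s₁' ν 0 / ∫ t in (0:ℝ)..1, s₁ μ t * s₁ ν t)
        (nhdsWithin ν {ν}ᶜ) (nhds ((ν + ν) * r k)) := by
      refine t4.congr' ?_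
      have ev1 : ∀ᶠ μ in nhdsWithin ν {ν}ᶜ, (∫ t in (0:ℝ)..1, s₁ μ t * s₁ ν t) ≠ 0 :=
        (t1.mono_left nhdsWithin_le_nhds).eventually_ne hNν
      have ev2 : ∀ᶠ μ in nhdsWithin ν {ν}ᶜ, μ + ν ≠ 0 := by
        refine t3.eventually_ne ?_
        have := hα0 k
        rw [← two_mul]
        exact mul_ne_zero two_ne_zero this
      filter_upwards [ev1, ev2, self_mem_nhdsWithin] with μ h1 h2 h3
      have h3' : μ - ν ≠ 0 := sub_ne_zero.2 h3
      have g := grn μ ν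
      rw [φ0 k, mul_zero, sub_zero] at g
      have g0 : s₁ μ 0 ≠ 0 := by
        intro hh
        rw [hh, zero_mul] at g
        have : (μ ^ 2 - ν ^ 2) ≠ 0 := by
          rw [sq_sub_sq]; exact mul_ne_zero h2 h3'
        exact mul_ne_zero this h1 g
      rw [vΔ, vD, neg_div_neg_eq]
      field_simp
      linear_combination s₁' μ 0 * g
    have := tendsto_nhds_unique t6 t5
    rw [pow_two (s₁' ν 0), ← this]; ring
  -- conclusion
  intro μ hμ
  have hs1 : s₁ μ 0 ≠ 0 := by
    intro h
    obtain ⟨k, hk⟩ := hall (μ ^ 2) (by rw [vΔ, h, neg_zero])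
    exact hμ k hk.symm
  have hs10 : s₁ 0 0 ≠ 0 := by
    intro h
    exact hΔ0 (by rw [vΔ0, h, neg_zero])
  have hsum := aux_hilbert _ (auxT_compact _ _ _ P.ha.cu P.hb.cu) P.symm e he hE
    (L 0) P.mem_closure (L μ)
  have hsum2 := hsum.mul_left (-(μ ^ 2) / (s₁ μ 0 * s₁ 0 0))
  convert! hsum2 using 1
  · funext k
    simp only [e, inner_smul_left, inner_smul_right]
    rw [innr _ (realφ k), innr 0 (real1 0 (by simp))]
    have g1 := grn μ (α k)
    have g2 := grn (α k) 0
    rw [φ0 k] at g1 g2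
    have hk : μ ^ 2 - α k ^ 2 ≠ 0 := sub_ne_zero.2 (hμ k)
    have hak := hα0 k
    have hrk := hr k
    have hNk := hN0 k
    have g1' : (∫ t in (0:ℝ)..1, s₁ μ t * s₁ (α k) t) =
        s₁ μ 0 * s₁' (α k) 0 / (μ ^ 2 - α k ^ 2) := by
      rw [eq_div_iff hk]; linear_combination g1
    have g2' : (∫ t in (0:ℝ)..1, s₁ (α k) t * s₁ 0 t) =
        -(s₁' (α k) 0 * s₁ 0 0) / (α k ^ 2) := by
      rw [eq_div_iff (pow_ne_zero 2 hak)]; linear_combination g2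
    have hrk' : r k = s₁' (α k) 0 ^ 2 / (‖L (α k)‖ : ℂ) ^ 2 / (2 * α k) := by
      rw [eq_div_iff (mul_ne_zero two_ne_zero hak)]; linear_combination hrk
    rw [g1', g2', hrk']
    simp only [map_inv₀, Complex.conj_ofReal]
    field_simp
  · rw [innr 0 (real1 0 (by simp)), vΔ, vD, vΔ0, vD0]
    have g := grn μ 0
    field_simp
    linear_combination g
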